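/- Let f: Z_p^m → Z_p^m be a map given by m power series with coefficients in Z_p tending to 0 (Tate analytic), and suppose every coefficient of f(x) − x is divisible by p^c for some integer c ≥ 2 (when p ≥ 3; c ≥ 3 for p = 2). Then f is bijective, and there exists an analytic map Φ: Z_p × Z_p^m → Z_p^m with Φ(n, x) = f^n(x) for all n ∈ Z and Φ(s+t, x) = Φ(s, Φ(t,x)); moreover all coefficients of Φ(t,x) − x are divisible by p^c. -/

import Mathlib

open Filter

namespace BP
variable {p : ℕ} [Fact p.Prime]

instance : NonarchimedeanRing ℤ_[p] where
  is_nonarchimedean := NonarchimedeanAddGroup.is_nonarchimedean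

lemma summable_iff {ι : Type*} (a : ι → ℤ_[p]) :
    Summable a ↔ Tendsto (fun i => ‖a i‖) cofinite (nhds 0) := by
  rw [NonarchimedeanAddGroup.summable_iff_tendsto_cofinite_zero, tendsto_zero_iff_norm_tendsto_zero]

lemma summable_iff' {ι : Type*} (a : ι → ℤ_[p]) :
    Summable a ↔ ∀ ε : ℝ, 0 < ε → {i | ε ≤ ‖a i‖}.Finite := by
  rw [summable_iff, Metric.tendsto_nhds]
  simp [Filter.eventually_cofinite]

/-- bounded multiples of summable families are summable -/
lemma summable_mul {ι : Type*} {a : ι → ℤ_[p]} (ha : Summable a) (b : ι → ℤ_[p]) :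
    Summable (fun i => a i * b i) := by
  rw [summable_iff'] at *
  intro ε hε
  refine (ha ε hε).subset fun i hi => ?_
  simp only [Set.mem_ofPred_eq, norm_mul] at *
  exact hi.trans (mul_le_of_le_one_right (norm_nonneg _) (PadicInt.norm_le_one _))

lemma summable_double {ι κ : Type*} {a : ι → ℤ_[p]} (ha : Summable a) {k : ι → κ → ℤ_[p]}
    (hk : ∀ i, Summable (k i)) : Summable (fun q : ι × κ => a q.1 * k q.1 q.2) := by
  rw [summable_iff'] at *
  intro ε hε
  refine (Set.Finite.biUnion (ha ε hε) (t := fun i => Prod.mk i '' {j | ε ≤ ‖k i j‖})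
    fun i _ => (((summable_iff' _).1 (hk i)) ε hε).image _).subset ?_
  rintro ⟨i, j⟩ h
  simp only [Set.mem_ofPred_eq, norm_mul] at h
  simp only [Set.mem_iUnion]
  refine ⟨i, h.trans (mul_le_of_le_one_right (norm_nonneg _) (PadicInt.norm_le_one _)), j,
    h.trans (mul_le_of_le_one_left (norm_nonneg _) (PadicInt.norm_le_one _)), rfl⟩

/-- regrouping a summable family -/
lemma regroup {ι τ : Type*} {F : ι → ℤ_[p]} (hF : Summable F) (φ : ι → τ) :
    ∃ G : τ → ℤ_[p], Summable G ∧ ∀ (M : τ → ℤ_[p]),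
      HasSum (fun t => G t * M t) (∑' i, F i * M (φ i)) := by
  refine ⟨fun t => ∑' i : φ ⁻¹' {t}, F i, (hF.hasSum.tsum_fiberwise φ).summable, fun M => ?_⟩
  have h := ((summable_mul hF (fun i => M (φ i))).hasSum.tsum_fiberwise φ)
  have e : (fun t => (∑' i : φ ⁻¹' {t}, F i) * M t)
      = fun t => ∑' i : φ ⁻¹' {t}, F i * M (φ i) := by
    ext1 t
    have h1 : Summable (fun i : φ ⁻¹' {t} => F i) := hF.subtype _
    rw [← h1.tsum_mul_right]
    refine tsum_congr fun i => ?_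
    have : φ i = t := i.2
    simp [this]
  rw [e]
  exact h

variable {m : ℕ}

noncomputable abbrev mon (I : Fin m → ℕ) (x : Fin m → ℤ_[p]) : ℤ_[p] := ∏ j, x j ^ I j

/-- restricted power series functions -/
def T (g : (Fin m → ℤ_[p]) → ℤ_[p]) : Prop :=
  ∃ a : (Fin m → ℕ) → ℤ_[p], Summable a ∧ ∀ x, HasSum (fun I => a I * mon I x) (g x)

lemma T_tsum {ι : Type*} {F : ι → ℤ_[p]} (hF : Summable F) (φ : ι → Fin m → ℕ)
    {g : (Fin m → ℤ_[p]) → ℤ_[p]} (hg : ∀ x, HasSum (fun i => F i * mon (φ i) x) (g x)) : T g := by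
  obtain ⟨G, hG, h⟩ := regroup hF φ
  refine ⟨G, hG, fun x => ?_⟩
  rw [← (hg x).tsum_eq]
  exact h (fun I => mon I x)

lemma T_mul {g h : (Fin m → ℤ_[p]) → ℤ_[p]} (hg : T g) (hh : T h) : T (fun x => g x * h x) := by
  obtain ⟨a, ha, hg⟩ := hg
  obtain ⟨b, hb, hh⟩ := hh
  refine T_tsum (ha.mul_of_nonarchimedean hb) (fun q => q.1 + q.2) fun x => ?_
  convert (hg x).mul_of_nonarchimedean (hh x) using 2 with q
  simp [mon, pow_add, Finset.prod_mul_distrib]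
  ring

lemma T_add {g h : (Fin m → ℤ_[p]) → ℤ_[p]} (hg : T g) (hh : T h) : T (fun x => g x + h x) := by
  obtain ⟨a, ha, hg⟩ := hg
  obtain ⟨b, hb, hh⟩ := hh
  refine ⟨_, ha.add hb, fun x => ?_⟩
  simpa [add_mul] using (hg x).add (hh x)

lemma T_mon (I : Fin m → ℕ) : T (fun x : Fin m → ℤ_[p] => mon I x) :=
  T_tsum (ι := Unit) (F := fun _ => 1) (hasSum_fintype _).summable (fun _ => I)
    fun x => by simp

lemma T_const (r : ℤ_[p]) : T (fun _ : Fin m → ℤ_[p] => r) :=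
  T_tsum (ι := Unit) (F := fun _ => r) (hasSum_fintype _).summable (fun _ => 0)
    fun x => by simp [mon]

lemma mon_single (i : Fin m) (x : Fin m → ℤ_[p]) : mon (Pi.single i 1) x = x i := by
  classical
  simp [mon, Pi.single_apply, pow_ite]

lemma T_coord (i : Fin m) : T (fun x : Fin m → ℤ_[p] => x i) := by
  simpa [mon_single] using T_mon (p := p) (Pi.single i 1 : Fin m → ℕ)

/-- infinite sums of Tate functions -/
lemma T_sum {ι : Type*} {w : ι → ℤ_[p]} (hw : Summable w) {k : ι → (Fin m → ℤ_[p]) → ℤ_[p]}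
    (hk : ∀ i, T (k i)) : T (fun x => ∑' i, w i * k i x) := by
  choose a ha hs using hk
  refine T_tsum (summable_double hw ha) (fun q => q.2) fun x => ?_
  have h := (summable_mul (summable_double hw ha) (fun q => mon q.2 x))
  have h2 := h.hasSum.prod_fiberwise (fun i => (by
    simpa [mul_assoc] using (hs i x).mul_left (w i) : HasSum _ (w i * k i x)))
  rw [h2.tsum_eq]
  exact h.hasSum

/-- congruence modulo `P` of Tate functions -/
def R (P : ℤ_[p]) (u v : (Fin m → ℤ_[p]) → ℤ_[p]) : Prop :=
  T v ∧ ∃ k, T k ∧ ∀ x, u x = v x + P * k x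

lemma R_one (P : ℤ_[p]) : R P (fun _ : Fin m → ℤ_[p] => 1) (fun _ => 1) :=
  ⟨T_const 1, _, T_const 0, by simp⟩

lemma R_mul {P : ℤ_[p]} {u v u' v' : (Fin m → ℤ_[p]) → ℤ_[p]} (h : R P u v) (h' : R P u' v') :
    R P (fun x => u x * u' x) (fun x => v x * v' x) := by
  obtain ⟨hv, k, hk, e⟩ := h
  obtain ⟨hv', k', hk', e'⟩ := h'
  refine ⟨T_mul hv hv', _, T_add (T_add (T_mul hk hv') (T_mul hv hk'))
    (T_mul (T_const P) (T_mul hk hk')), fun x => ?_⟩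
  beta_reduce; rw [e, e']; ring

lemma R_pow {P : ℤ_[p]} {u v : (Fin m → ℤ_[p]) → ℤ_[p]} (h : R P u v) (n : ℕ) :
    R P (fun x => u x ^ n) (fun x => v x ^ n) := by
  induction n with
  | zero => simpa using R_one P
  | succ n ih => simpa [pow_succ] using R_mul ih h

lemma R_prod {P : ℤ_[p]} {ι : Type*} (s : Finset ι) {u v : ι → (Fin m → ℤ_[p]) → ℤ_[p]}
    (h : ∀ i, R P (u i) (v i)) : R P (fun x => ∏ i ∈ s, u i x) (fun x => ∏ i ∈ s, v i x) := by
  classical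
  induction s using Finset.induction_on with
  | empty => simpa using R_one P
  | insert a s ha ih => simpa [Finset.prod_insert ha] using R_mul (h a) ih

lemma T_comp {P : ℤ_[p]} {f : (Fin m → ℤ_[p]) → Fin m → ℤ_[p]}
    (hf : ∀ i, R P (fun x => f x i) (fun x => x i)) {g : (Fin m → ℤ_[p]) → ℤ_[p]} (hg : T g) :
    ∃ h, T h ∧ ∀ x, g (f x) = g x + P * h x := by
  obtain ⟨a, ha, hg⟩ := hg
  have := fun I : Fin m → ℕ => (R_prod Finset.univ (fun i => R_pow (hf i) (I i))).2
  choose k hk e using this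
  refine ⟨_, T_sum ha hk, fun x => ?_⟩
  rw [← (hg x).tsum_eq, ← (hg (f x)).tsum_eq, ← (summable_mul ha _).tsum_mul_left,
    ← (hg x).summable.tsum_add ((summable_mul ha _).mul_left _)]
  refine tsum_congr fun I => ?_
  have := e I x
  beta_reduce at this
  rw [mon, this]; ring

lemma fwd {P : ℤ_[p]} {f : (Fin m → ℤ_[p]) → Fin m → ℤ_[p]}
    (hf : ∀ i, R P (fun x => f x i) (fun x => x i)) (n : ℕ) :
    ∀ {g : (Fin m → ℤ_[p]) → ℤ_[p]}, T g →
    ∃ h, T h ∧ ∀ x, ((fwdDiff 1)^[n] (fun N : ℕ => g (f^[N] x))) 0 = P ^ n * h x := by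
  induction n with
  | zero => intro g hg; exact ⟨g, hg, by simp⟩
  | succ n ih =>
    intro g hg
    obtain ⟨g1, hg1, e1⟩ := T_comp hf hg
    obtain ⟨h, hh, e⟩ := ih hg1
    refine ⟨h, hh, fun x => ?_⟩
    have : fwdDiff 1 (fun N : ℕ => g (f^[N] x)) = P • (fun N : ℕ => g1 (f^[N] x)) := by
      ext N
      simp [fwdDiff, Function.iterate_succ_apply', e1]
    rw [Function.iterate_succ_apply, this, fwdDiff_iter_const_smul, Pi.smul_apply, e, smul_eq_mul]
    ring

lemma weights (C : ℕ) (hC : 2 ≤ C) : ∃ w : ℕ → ℤ_[p], Summable w ∧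
    ∀ n, ((n + 1).factorial : ℤ_[p]) * w n = ((p : ℤ_[p]) ^ C) ^ n := by
  have h : ∀ n : ℕ, ∃ v : ℤ_[p], ((n + 1).factorial : ℤ_[p]) * v = (p : ℤ_[p]) ^ n := by
    intro n
    have hlt := padicValNat_factorial_lt_of_ne_zero p (n := n + 1) (by omega)
    have h0 : ((n + 1).factorial : ℤ_[p]) ≠ 0 := by exact_mod_cast Nat.factorial_ne_zero _
    have hv : (((n + 1).factorial : ℤ_[p])).valuation = padicValNat p (n + 1).factorial := by
      simp [PadicInt.valuation]
    have hs := PadicInt.unitCoeff_spec h0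
    have : ((n + 1).factorial : ℤ_[p]) ∣ (p : ℤ_[p]) ^ n := by
      rw [hs, Units.mul_left_dvd, hv]
      exact pow_dvd_pow _ (by omega)
    obtain ⟨v, hv⟩ := this
    exact ⟨v, hv.symm⟩
  choose v hv using h
  refine ⟨fun n => (p : ℤ_[p]) ^ n * ((p : ℤ_[p]) ^ ((C - 2) * n) * v n), summable_mul ?_ _,
    fun n => ?_⟩
  · rw [NonarchimedeanAddGroup.summable_iff_tendsto_cofinite_zero, Nat.cofinite_eq_atTop]
    exact tendsto_pow_atTop_nhds_zero_of_norm_lt_one (by rw [PadicInt.norm_p]; exact inv_lt_one_of_one_lt₀ (by exact_mod_cast (Fact.out : p.Prime).one_lt))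
  · obtain ⟨d, rfl⟩ := Nat.exists_eq_add_of_le hC
    calc _ = (p : ℤ_[p]) ^ n * (p : ℤ_[p]) ^ ((2 + d - 2) * n) * (((n + 1).factorial : ℤ_[p]) * v n) := by ring
      _ = _ := by rw [hv, ← pow_mul]; simp only [← pow_add]; congr 1; simp; ring

/-- nonexpanding -/
lemma lip_mul {δ : ℝ} {a a' b b' : ℤ_[p]} (h : ‖a - a'‖ ≤ δ) (h' : ‖b - b'‖ ≤ δ) :
    ‖a * b - a' * b'‖ ≤ δ := by
  have : a * b - a' * b' = a * (b - b') + (a - a') * b' := by ring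
  rw [this]
  refine (PadicInt.nonarchimedean _ _).trans (max_le ?_ ?_) <;> rw [norm_mul]
  · exact (mul_le_of_le_one_left (norm_nonneg _) (PadicInt.norm_le_one _)).trans h'
  · exact (mul_le_of_le_one_right (norm_nonneg _) (PadicInt.norm_le_one _)).trans h

lemma lip_pow {δ : ℝ} (hδ : 0 ≤ δ) {a a' : ℤ_[p]} (h : ‖a - a'‖ ≤ δ) (n : ℕ) :
    ‖a ^ n - a' ^ n‖ ≤ δ := by
  induction n with
  | zero => simpa
  | succ n ih => rw [pow_succ, pow_succ]; exact lip_mul ih h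

lemma lip_prod {δ : ℝ} (hδ : 0 ≤ δ) {ι : Type*} (s : Finset ι) {a a' : ι → ℤ_[p]}
    (h : ∀ i, ‖a i - a' i‖ ≤ δ) : ‖∏ i ∈ s, a i - ∏ i ∈ s, a' i‖ ≤ δ := by
  classical
  induction s using Finset.induction_on with
  | empty => simpa
  | insert a s ha ih => rw [Finset.prod_insert ha, Finset.prod_insert ha]; exact lip_mul (h _) ih

lemma cont_tsum {ι Y : Type*} [PseudoMetricSpace Y] {a : ι → ℤ_[p]} (ha : Summable a)
    {M : ι → Y → ℤ_[p]} (hM : ∀ i y y', ‖M i y - M i y'‖ ≤ dist y y') :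
    Continuous (fun y => ∑' i, a i * M i y) := by
  refine LipschitzWith.continuous (K := 1) (LipschitzWith.of_dist_le_mul fun y y' => ?_)
  rw [dist_eq_norm, ← (summable_mul ha _).tsum_sub (summable_mul ha _)]
  simp only [← mul_sub, NNReal.coe_one, one_mul]
  refine IsUltrametricDist.norm_tsum_le_of_forall_le_of_nonneg dist_nonneg fun i => ?_
  rw [norm_mul]
  exact (mul_le_of_le_one_left (norm_nonneg _) (PadicInt.norm_le_one _)).trans (hM i y y')

/-- the flow, coordinatewise -/
lemma flow {P : ℤ_[p]} {f : (Fin m → ℤ_[p]) → Fin m → ℤ_[p]}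
    (hf : ∀ i, R P (fun x => f x i) (fun x => x i)) {w : ℕ → ℤ_[p]} (hw : Summable w)
    (hwf : ∀ n, ((n + 1).factorial : ℤ_[p]) * w n = P ^ n) (i : Fin m) :
    ∃ G : ℕ × (Fin m → ℕ) → ℤ_[p], Summable G ∧
      ∀ (N : ℕ) x, f^[N] x i = x i + P * ∑' q : ℕ × (Fin m → ℕ), G q * ((N : ℤ_[p]) ^ q.1 * mon q.2 x) := by
  have := fun n => fwd hf n (T_coord i)
  choose h hT hh using this
  choose a ha hs using hT
  let s : ℕ → ℕ → ℤ_[p] := fun n k => (descPochhammer ℤ_[p] (n + 1)).coeff k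
  have hsum : ∀ n, Summable (s n) := fun n =>
    summable_of_hasFiniteSupport (by
      refine (Finset.finite_toSet (descPochhammer ℤ_[p] (n + 1)).support).subset fun k hk => ?_
      simpa [s] using hk)
  have hev : ∀ n t, HasSum (fun k => s n k * t ^ k) ((descPochhammer ℤ_[p] (n + 1)).eval t) := by
    intro n t
    rw [Polynomial.eval_eq_sum, Polynomial.sum]
    exact hasSum_sum_of_ne_finset_zero (fun k hk => by simp [s, Polynomial.notMem_support_iff.1 hk])
  have h1 : ∀ n, Summable (fun q : ℕ × (Fin m → ℕ) => s n q.1 * a (n+1) q.2) :=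
    fun n => (hsum n).mul_of_nonarchimedean (ha (n+1))
  have h2 := summable_double hw h1
  obtain ⟨G, hG, hM⟩ := regroup h2 (fun q => q.2)
  refine ⟨G, hG, fun N x => ?_⟩
  rw [(hM (fun q => (N : ℤ_[p]) ^ q.1 * mon q.2 x)).tsum_eq]
  have h3 := (summable_mul h2 (fun q => (N : ℤ_[p]) ^ q.2.1 * mon q.2.2 x)).hasSum
  have h4 := h3.prod_fiberwise (g := fun n => w n * ((descPochhammer ℤ_[p] (n + 1)).eval (N : ℤ_[p]) * h (n+1) x))
    (fun n => by
      have := ((hev n N).mul_of_nonarchimedean (hs (n+1) x)).mul_left (w n)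
      refine (congrArg (fun F => HasSum F _) (funext fun q => ?_)).mpr this
      beta_reduce
      ring)
  have h5 : ∀ n, P * (w n * ((descPochhammer ℤ_[p] (n + 1)).eval (N : ℤ_[p]) * h (n+1) x))
      = (N.choose (n+1)) • ((fwdDiff 1)^[n+1] (fun N : ℕ => f^[N] x i)) 0 := by
    intro n
    rw [hh, descPochhammer_eval_eq_descFactorial, Nat.descFactorial_eq_factorial_mul_choose, pow_succ, ← hwf]
    simp only [nsmul_eq_mul, Nat.cast_mul]
    ring
  have h6 := h4.mul_left P
  simp only [h5] at h6
  have h7 := h6.unique (hasSum_sum_of_ne_finset_zero (s := Finset.range N) (fun k hk => by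
    rw [Nat.choose_eq_zero_of_lt, zero_smul]; simp at hk; omega))
  rw [h7]
  have h8 := shift_eq_sum_fwdDiff_iter 1 (fun N : ℕ => f^[N] x i) N 0
  rw [Finset.sum_range_succ'] at h8
  simp only [zero_add, smul_eq_mul, mul_one] at h8
  rw [h8, add_comm]
  simp

end BP


/-- Bell–Poonen over ℚ_p: a Tate-analytic self-map f of ℤ_p^m whose
coefficients are congruent to those of the identity mod p^c (c ≥ 2, and c ≥ 3 if p = 2)
is bijective and embeds into a Tate-analytic flow Φ with Φ(n,·) = f^n for all n ∈ ℤ,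
Φ(s+t,·) = Φ(s,·)∘Φ(t,·), and Φ(t,x) ≡ x mod p^c coefficientwise. -/
theorem stmt6 (p : ℕ) [Fact p.Prime] (m : ℕ)
    (c : (Fin m → ℕ) → Fin m → ℤ_[p])
    (hdecay : ∀ i, Tendsto (fun I => ‖c I i‖) cofinite (nhds 0))
    (f : (Fin m → ℤ_[p]) → Fin m → ℤ_[p])
    (hf : ∀ x i, f x i = ∑' I : Fin m → ℕ, c I i * ∏ j, x j ^ I j)
    (C : ℕ) (hC : (if p = 2 then 3 else 2) ≤ C)
    (hcong : ∀ I i, (p : ℤ_[p]) ^ C ∣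
        c I i - (if I = Pi.single i 1 then 1 else 0)) :
    Function.Bijective f ∧
    ∃ (e : ℕ → (Fin m → ℕ) → Fin m → ℤ_[p])
      (Φ : ℤ_[p] → (Fin m → ℤ_[p]) → Fin m → ℤ_[p]),
      (∀ i, Tendsto (fun q : ℕ × (Fin m → ℕ) => ‖e q.1 q.2 i‖) cofinite (nhds 0)) ∧
      (∀ t x i, Φ t x i = ∑' q : ℕ × (Fin m → ℕ),
          t ^ q.1 * (e q.1 q.2 i * ∏ j, x j ^ q.2 j)) ∧
      (∀ n : ℕ, ∀ x, Φ (n : ℤ_[p]) x = f^[n] x) ∧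
      (∀ n : ℕ, ∀ x, Φ (-(n : ℤ_[p])) (f^[n] x) = x) ∧
      (∀ s t : ℤ_[p], ∀ x, Φ (s + t) x = Φ s (Φ t x)) ∧
      (∀ n I i, (p : ℤ_[p]) ^ C ∣
          e n I i - (if n = 0 ∧ I = Pi.single i 1 then 1 else 0)) := by

  have hC2 : 2 ≤ C := by split_ifs at hC <;> omega
  set P : ℤ_[p] := (p : ℤ_[p]) ^ C with hP
  have hP0 : P ≠ 0 := pow_ne_zero _ (by exact_mod_cast (Fact.out : p.Prime).ne_zero)
  have hδ : ∀ (i : Fin m) x, HasSum (fun I : Fin m → ℕ =>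
      (if I = Pi.single i 1 then (1 : ℤ_[p]) else 0) * BP.mon I x) (x i) := by
    intro i x
    have := hasSum_single (f := fun I : Fin m → ℕ =>
      (if I = Pi.single i 1 then (1 : ℤ_[p]) else 0) * BP.mon I x) (Pi.single i 1)
      (fun I hI => by simp [hI])
    simpa only [if_true, one_mul, BP.mon_single] using this
  have hR : ∀ i, BP.R P (fun x => f x i) (fun x => x i) := by
    intro i
    refine ⟨BP.T_coord i, ?_⟩
    choose d hd using fun I => hcong I i
    have hcs : Summable (fun I => c I i) := (BP.summable_iff _).2 (hdecay i)
    have hds : Summable d := by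
      have h1 : Summable (fun I : Fin m → ℕ => (if I = Pi.single i 1 then (1 : ℤ_[p]) else 0)) :=
        (hasSum_ite_eq _ _).summable
      have h2 := (BP.summable_iff _).1 (hcs.sub h1)
      rw [BP.summable_iff]
      have h3 := h2.const_mul ‖P‖⁻¹
      rw [mul_zero] at h3
      refine h3.congr fun I => ?_
      rw [hd, norm_mul, inv_mul_cancel_left₀ (norm_ne_zero_iff.2 hP0)]
    refine ⟨fun x => ∑' I, d I * BP.mon I x, ⟨d, hds, fun x => (BP.summable_mul hds _).hasSum⟩,
      fun x => ?_⟩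
    have h := (hδ i x).add ((BP.summable_mul hds (fun I => BP.mon I x)).hasSum.mul_left P)
    beta_reduce
    rw [← h.tsum_eq, hf]
    refine tsum_congr fun I => ?_
    rw [← mul_assoc, ← hd, ← add_mul, add_sub_cancel]
  obtain ⟨w, hw, hwf⟩ := BP.weights (p := p) C hC2
  choose G hG hfl using BP.flow hR hw hwf
  let e : ℕ → (Fin m → ℕ) → Fin m → ℤ_[p] := fun n I i =>
    (if n = 0 ∧ I = Pi.single i 1 then 1 else 0) + P * G i (n, I)
  let Φ : ℤ_[p] → (Fin m → ℤ_[p]) → Fin m → ℤ_[p] := fun t x i => ∑' q : ℕ × (Fin m → ℕ),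
          t ^ q.1 * (e q.1 q.2 i * ∏ j, x j ^ q.2 j)
  have hδs : ∀ i, Summable (fun q : ℕ × (Fin m → ℕ) =>
      if q.1 = 0 ∧ q.2 = Pi.single i 1 then (1 : ℤ_[p]) else 0) := by
    intro i
    have := (hasSum_ite_eq ((0, Pi.single i 1) : ℕ × (Fin m → ℕ)) (1 : ℤ_[p])).summable
    simpa only [Prod.ext_iff] using this
  have hes : ∀ i, Summable (fun q : ℕ × (Fin m → ℕ) => e q.1 q.2 i) := fun i =>
    (hδs i).add ((hG i).mul_left P)
  have hΦ' : ∀ t x i, Φ t x i = ∑' q : ℕ × (Fin m → ℕ), e q.1 q.2 i * (t ^ q.1 * BP.mon q.2 x) :=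
    fun t x i => tsum_congr fun q => by rw [BP.mon]; ring
  have hΦ : ∀ t x i, Φ t x i = x i + P * ∑' q : ℕ × (Fin m → ℕ), G i q * (t ^ q.1 * BP.mon q.2 x) := by
    intro t x i
    rw [hΦ']
    have h1 := hasSum_single (f := fun q : ℕ × (Fin m → ℕ) =>
      (if q.1 = 0 ∧ q.2 = Pi.single i 1 then (1 : ℤ_[p]) else 0) * (t ^ q.1 * BP.mon q.2 x))
      (0, Pi.single i 1) (fun q hq => by
        rw [if_neg, zero_mul]
        exact fun h => hq (Prod.ext h.1 h.2))
    simp only [and_self, if_true, one_mul, pow_zero, BP.mon_single] at h1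
    have h2 := h1.add ((BP.summable_mul (hG i) (fun q => t ^ q.1 * BP.mon q.2 x)).hasSum.mul_left P)
    rw [← h2.tsum_eq]
    refine tsum_congr fun q => ?_
    simp only [e]
    ring
  have hnat : ∀ n : ℕ, ∀ x, Φ (n : ℤ_[p]) x = f^[n] x := by
    intro n x
    ext1 i
    rw [hΦ, hfl]
  have hcont : Continuous (fun y : ℤ_[p] × (Fin m → ℤ_[p]) => Φ y.1 y.2) := by
    refine continuous_pi fun i => ?_
    simp only [hΦ']
    refine BP.cont_tsum (hes i) (M := fun q (y : ℤ_[p] × (Fin m → ℤ_[p])) => y.1 ^ q.1 * BP.mon q.2 y.2) fun q y y' => ?_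
    refine BP.lip_mul (BP.lip_pow dist_nonneg ?_ _) (BP.lip_prod dist_nonneg _ fun j =>
      BP.lip_pow dist_nonneg ?_ _)
    · rw [← dist_eq_norm]; exact le_max_left _ _
    · rw [← dist_eq_norm]; exact (dist_le_pi_dist _ _ _).trans (le_max_right _ _)
  have hadd : ∀ s t : ℤ_[p], ∀ x, Φ (s + t) x = Φ s (Φ t x) := by
    intro s t x
    have hd : DenseRange (Prod.map (Nat.cast : ℕ → ℤ_[p]) (Nat.cast : ℕ → ℤ_[p])) :=
      PadicInt.denseRange_natCast.prodMap PadicInt.denseRange_natCast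
    have h1 : Continuous (fun q : ℤ_[p] × ℤ_[p] => Φ (q.1 + q.2) x) :=
      hcont.comp (f := fun q : ℤ_[p] × ℤ_[p] => (q.1 + q.2, x)) (by fun_prop)
    have h2 : Continuous (fun q : ℤ_[p] × ℤ_[p] => Φ q.2 x) :=
      hcont.comp (f := fun q : ℤ_[p] × ℤ_[p] => (q.2, x)) (by fun_prop)
    have h3 : Continuous (fun q : ℤ_[p] × ℤ_[p] => Φ q.1 (Φ q.2 x)) :=
      hcont.comp (f := fun q : ℤ_[p] × ℤ_[p] => (q.1, Φ q.2 x)) (by fun_prop)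
    refine congr_fun (hd.equalizer h1 h3 ?_) (s, t)
    ext1 ⟨a, b⟩
    simp only [Function.comp_apply, Prod.map_apply]
    rw [← Nat.cast_add, hnat, hnat, hnat, Function.iterate_add_apply]
  have hzero : ∀ x, Φ 0 x = x := fun x => by simpa using hnat 0 x
  have hone : ∀ x, Φ 1 x = f x := fun x => by simpa using hnat 1 x
  refine ⟨⟨?_, ?_⟩, e, Φ, ?_, fun _ _ _ => rfl, hnat, ?_, hadd, ?_⟩
  · refine Function.LeftInverse.injective (g := Φ (-1)) fun x => ?_
    rw [← hone, ← hadd, neg_add_cancel, hzero]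
  · refine Function.RightInverse.surjective (g := Φ (-1)) fun x => ?_
    rw [← hone, ← hadd, add_neg_cancel, hzero]
  · exact fun i => (BP.summable_iff _).1 (hes i)
  · intro n x
    rw [← hnat, ← hadd, neg_add_cancel, hzero]
  · intro n I i
    exact ⟨G i (n, I), by simp [e]⟩
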